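/- arXiv:2509.23496 — 3 statements merged into one kernel-verified Lean document; each statement's English description precedes it below -/
import Mathlib

section
/- Let d ≥ 1 be an integer, let 0 < γ < 1, let δ = 1/γ, and let ρ be a soft profile with decay exponent δ. Then there exist constants 0 < c' ≤ C' < ∞ (depending only on d, γ and the constants in the definition of ρ) such that for every u ∈ (0,1] and every R ≥ 2 one has c'·min(u^{−1} R^{d(1−δ)}(1 + log₊(u R^{dδ})), 1) ≤ min( ∫_{{x ∈ ℝ^d : |x| ≥ R}} ∫_0^1 ρ(|x|^d (u v)^γ) dv dx , 1 ) ≤ C'·min(u^{−1} R^{d(1−δ)}(1 + log₊(u R^{dδ})), 1). -/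
open MeasureTheory Real Set

lemma int_min (s : ℝ) (hs : 1 ≤ s) :
    IntegrableOn (fun v : ℝ => min 1 (s * v)⁻¹) (Ioc 0 1) ∧
    ∫ v in Ioc (0:ℝ) 1, min 1 (s * v)⁻¹ = (1 + log s) / s := by
  have hs0 : 0 < s := by linarith
  have hi : IntegrableOn (fun v : ℝ => min 1 (s * v)⁻¹) (Ioc 0 1) := by
    apply Measure.integrableOn_of_bounded (M := 1) (by simp)
    · exact (by fun_prop : Measurable (fun v : ℝ => min 1 (s * v)⁻¹)).aestronglyMeasurable
    · filter_upwards [ae_restrict_mem measurableSet_Ioc] with v hv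
      have : 0 ≤ (s*v)⁻¹ := inv_nonneg.2 (mul_nonneg hs0.le hv.1.le)
      rw [Real.norm_of_nonneg (le_min zero_le_one this)]
      exact min_le_left _ _
  refine ⟨hi, ?_⟩
  have h1 : s⁻¹ ≤ 1 := inv_le_one_of_one_le₀ hs
  have h0 : 0 < s⁻¹ := inv_pos.2 hs0
  rw [← Ioc_union_Ioc_eq_Ioc h0.le h1] at hi ⊢
  rw [setIntegral_union (by simp) measurableSet_Ioc (hi.mono_set subset_union_left)
    (hi.mono_set subset_union_right)]
  have e1 : ∫ v in Ioc (0:ℝ) s⁻¹, min 1 (s * v)⁻¹ = ∫ v in Ioc (0:ℝ) s⁻¹, (1:ℝ) := by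
    apply setIntegral_congr_fun measurableSet_Ioc
    intro v hv
    apply min_eq_left
    apply (one_le_inv₀ (mul_pos hs0 hv.1)).2
    calc s * v ≤ s * s⁻¹ := by gcongr; exact hv.2
      _ = 1 := by field_simp
  have e2 : ∫ v in Ioc s⁻¹ 1, min 1 (s * v)⁻¹ = ∫ v in Ioc s⁻¹ 1, s⁻¹ * v⁻¹ := by
    apply setIntegral_congr_fun measurableSet_Ioc
    intro v hv
    simp only
    rw [← mul_inv]
    apply min_eq_right
    apply inv_le_one_of_one_le₀
    calc 1 = s * s⁻¹ := by field_simp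
      _ ≤ s * v := by gcongr; exact hv.1.le
  rw [e1, e2, integral_const_mul, ← intervalIntegral.integral_of_le h1,
    integral_inv_of_pos h0 one_pos]
  simp [h0.le]
  field_simp

lemma rho_pt (δ : ℝ) (hδ : 1 < δ) (ρ : ℝ → ℝ) (c C : ℝ) 
    (hρ_range : ∀ x : ℝ, 0 ≤ x → 0 ≤ ρ x ∧ ρ x ≤ 1)
    (hρ_mono : AntitoneOn ρ (Ici (0 : ℝ)))
    (hρ_bound : ∀ x : ℝ, 1 ≤ x → c * x ^ (-δ) ≤ ρ x ∧ ρ x ≤ C * x ^ (-δ))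
    (t : ℝ) (ht : 0 < t) :
    c * min 1 (t ^ δ)⁻¹ ≤ ρ t ∧ ρ t ≤ max C 1 * min 1 (t ^ δ)⁻¹ := by
  rcases le_total 1 t with h | h
  · have h1 : 1 ≤ t ^ δ := Real.one_le_rpow h (by linarith)
    rw [min_eq_right (inv_le_one_of_one_le₀ h1), ← Real.rpow_neg ht.le]
    refine ⟨(hρ_bound t h).1, (hρ_bound t h).2.trans ?_⟩
    gcongr
    exact le_max_left _ _
  · have h1 : t ^ δ ≤ 1 := Real.rpow_le_one ht.le h (by linarith)
    rw [min_eq_left ((one_le_inv₀ (by positivity)).2 h1), mul_one, mul_one]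
    refine ⟨?_, (hρ_range t ht.le).2.trans (le_max_right _ _)⟩
    have := (hρ_bound 1 le_rfl).1
    rw [Real.one_rpow, mul_one] at this
    exact this.trans (hρ_mono (mem_Ici.2 ht.le) (mem_Ici.2 zero_le_one) h)

lemma inner_int (γ : ℝ) (hγ0 : 0 < γ) (ρ : ℝ → ℝ)
    (hρ_range : ∀ x : ℝ, 0 ≤ x → 0 ≤ ρ x ∧ ρ x ≤ 1)
    (hρ_mono : AntitoneOn ρ (Ici (0 : ℝ))) (u A : ℝ) (hu : 0 < u) (hA : 0 ≤ A) :
    IntegrableOn (fun v : ℝ => ρ (A * (u * v) ^ γ)) (Ioc 0 1) := by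
  apply IntegrableOn.mono_set (t := Icc 0 1) _ Ioc_subset_Icc_self
  apply AntitoneOn.integrableOn_isCompact isCompact_Icc
  intro x hx y hy hxy
  have hx0 : 0 ≤ x := hx.1
  have hy0 : 0 ≤ y := hy.1
  apply hρ_mono
  · simp only [mem_Ici]; positivity
  · simp only [mem_Ici]; positivity
  · gcongr

lemma inner_bd (γ δ : ℝ) (hγ0 : 0 < γ) (hγ1 : γ < 1) (hδ : δ = 1 / γ) (ρ : ℝ → ℝ) (c C : ℝ)
    (hρ_range : ∀ x : ℝ, 0 ≤ x → 0 ≤ ρ x ∧ ρ x ≤ 1)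
    (hρ_mono : AntitoneOn ρ (Ici (0 : ℝ)))
    (hρ_bound : ∀ x : ℝ, 1 ≤ x → c * x ^ (-δ) ≤ ρ x ∧ ρ x ≤ C * x ^ (-δ))
    (u A : ℝ) (hu : 0 < u) (hA : 0 < A) (hs : 1 ≤ u * A ^ δ) :
    c * ((1 + log (u * A ^ δ)) / (u * A ^ δ)) ≤ ∫ v in Ioc (0 : ℝ) 1, ρ (A * (u * v) ^ γ) ∧
    ∫ v in Ioc (0 : ℝ) 1, ρ (A * (u * v) ^ γ) ≤
      max C 1 * ((1 + log (u * A ^ δ)) / (u * A ^ δ)) := by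
  obtain ⟨hi, he⟩ := int_min _ hs
  have hf := inner_int γ hγ0 ρ hρ_range hρ_mono u A hu hA.le
  have hδone : 1 < δ := by rw [hδ]; exact (one_lt_div hγ0).2 hγ1
  have key : ∀ v ∈ Ioc (0:ℝ) 1, (A * (u * v) ^ γ) ^ δ = u * A ^ δ * v := by
    intro v hv
    have hv0 : 0 < v := hv.1
    rw [Real.mul_rpow hA.le (by positivity), ← Real.rpow_mul (by positivity)]
    have : γ * δ = 1 := by rw [hδ]; field_simp
    rw [this, Real.rpow_one]; ring
  rw [← he, ← integral_const_mul, ← integral_const_mul]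
  constructor
  · apply setIntegral_mono_on (hi.const_mul _) hf measurableSet_Ioc
    intro v hv
    have hv0 : 0 < v := hv.1
    have := (rho_pt δ hδone ρ c C hρ_range hρ_mono hρ_bound (A * (u * v) ^ γ) (by positivity)).1
    rwa [key v hv] at this
  · apply setIntegral_mono_on hf (hi.const_mul _) measurableSet_Ioc
    intro v hv
    have hv0 : 0 < v := hv.1
    have := (rho_pt δ hδone ρ c C hρ_range hρ_mono hρ_bound (A * (u * v) ^ γ) (by positivity)).2
    rwa [key v hv] at this

/-- pointwise bounds of the radial density -/
lemma dens_bd (d : ℕ) (hd : 1 ≤ d) (δ : ℝ) (hδ : 1 < δ) (u R r : ℝ) (hu : 0 < u) (hR : 0 < R)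
    (hr : R ≤ r) (hs : 1 ≤ u * R ^ ((d:ℝ) * δ)) :
    u⁻¹ * (1 + log (u * R ^ ((d:ℝ) * δ))) * r ^ ((d:ℝ) * (1 - δ) - 1) ≤
      r ^ (d - 1) * ((1 + log (u * r ^ ((d:ℝ) * δ))) / (u * r ^ ((d:ℝ) * δ))) ∧
    r ^ (d - 1) * ((1 + log (u * r ^ ((d:ℝ) * δ))) / (u * r ^ ((d:ℝ) * δ))) ≤
      (1 + 2 * δ / (δ - 1)) * (u⁻¹ * (1 + log (u * R ^ ((d:ℝ) * δ))) *
        R ^ ((d:ℝ) * (1 - δ) / 2)) * r ^ ((d:ℝ) * (1 - δ) / 2 - 1) := by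
  have hr0 : 0 < r := hR.trans_le hr
  have hd0 : (0:ℝ) < d := by exact_mod_cast hd
  have hL : 0 ≤ log (u * R ^ ((d:ℝ) * δ)) := log_nonneg hs
  have hLr : log (u * r ^ ((d:ℝ) * δ)) =
      log (u * R ^ ((d:ℝ) * δ)) + d * δ * log (r / R) := by
    rw [log_mul hu.ne' (by positivity), log_mul hu.ne' (by positivity), log_rpow hr0, log_rpow hR,
      log_div hr0.ne' hR.ne']
    ring
  have hrR : 1 ≤ r / R := (one_le_div hR).2 hr
  have hlog0 : 0 ≤ log (r / R) := log_nonneg hrR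
  have hpow : r ^ (d - 1) / r ^ ((d:ℝ) * δ) = r ^ ((d:ℝ) * (1 - δ) - 1) := by
    rw [← Real.rpow_natCast, ← Real.rpow_sub hr0, Nat.cast_sub hd]
    congr 1; push_cast; ring
  have e : r ^ (d - 1) * ((1 + log (u * r ^ ((d:ℝ) * δ))) / (u * r ^ ((d:ℝ) * δ))) =
      u⁻¹ * (1 + log (u * r ^ ((d:ℝ) * δ))) * r ^ ((d:ℝ) * (1 - δ) - 1) := by
    rw [← hpow]; field_simp
  rw [e, hLr]
  have hδ0 : 0 < δ := by linarith
  set L := log (u * R ^ ((d:ℝ) * δ)) with hLdef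
  constructor
  · have : 0 ≤ d * δ * log (r / R) := by positivity
    gcongr
    linarith
  · have ha : 0 < (d:ℝ) * (δ - 1) / 2 := by have := sub_pos.2 hδ; positivity
    have h1 := Real.log_le_rpow_div (x := r / R) (by positivity) ha
    have h2 : 1 ≤ (r / R) ^ ((d:ℝ) * (δ - 1) / 2) := Real.one_le_rpow hrR ha.le
    have h3 : 1 + (L + d * δ * log (r / R)) ≤
        (1 + 2 * δ / (δ - 1)) * (1 + L) * (r / R) ^ ((d:ℝ) * (δ - 1) / 2) := by
      set X := (r / R) ^ ((d:ℝ) * (δ - 1) / 2)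
      have h4 : d * δ * log (r / R) ≤ 2 * δ / (δ - 1) * X := by
        calc d * δ * log (r / R) ≤ d * δ * (X / ((d:ℝ) * (δ - 1) / 2)) := by gcongr
          _ = _ := by
            have := (sub_pos.2 hδ).ne'
            field_simp
      have h5 : 0 ≤ 2 * δ / (δ - 1) := by have := sub_pos.2 hδ; positivity
      have h6 : 0 ≤ 2 * δ / (δ - 1) * X * L := by positivity
      nlinarith
    have h7 : (r / R) ^ ((d:ℝ) * (δ - 1) / 2) * r ^ ((d:ℝ) * (1 - δ) - 1) =
        R ^ ((d:ℝ) * (1 - δ) / 2) * r ^ ((d:ℝ) * (1 - δ) / 2 - 1) := by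
      rw [Real.div_rpow hr0.le hR.le, div_eq_mul_inv, ← Real.rpow_neg hR.le,
        mul_right_comm, ← Real.rpow_add hr0, mul_comm]
      congr 2 <;> ring
    calc u⁻¹ * (1 + (L + d * δ * log (r / R))) * r ^ ((d:ℝ) * (1 - δ) - 1)
        ≤ u⁻¹ * ((1 + 2 * δ / (δ - 1)) * (1 + L) * (r / R) ^ ((d:ℝ) * (δ - 1) / 2)) *
          r ^ ((d:ℝ) * (1 - δ) - 1) := by gcongr
      _ = (1 + 2 * δ / (δ - 1)) * (u⁻¹ * (1 + L)) * ((r / R) ^ ((d:ℝ) * (δ - 1) / 2) *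
          r ^ ((d:ℝ) * (1 - δ) - 1)) := by ring
      _ = _ := by rw [h7]; ring

/-- the radial function -/
noncomputable def hrad (d : ℕ) (γ u : ℝ) (ρ : ℝ → ℝ) (r : ℝ) : ℝ :=
  ∫ v in Ioc (0 : ℝ) 1, ρ (r ^ d * (u * v) ^ γ)

lemma hrad_anti (d : ℕ) (γ : ℝ) (hγ0 : 0 < γ) (ρ : ℝ → ℝ)
    (hρ_range : ∀ x : ℝ, 0 ≤ x → 0 ≤ ρ x ∧ ρ x ≤ 1)
    (hρ_mono : AntitoneOn ρ (Ici (0 : ℝ))) (u : ℝ) (hu : 0 < u) :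
    AntitoneOn (hrad d γ u ρ) (Ici 0) := by
  intro x hx y hy hxy
  have hx0 : 0 ≤ x := hx
  have hy0 : 0 ≤ y := hy
  apply setIntegral_mono_on (inner_int γ hγ0 ρ hρ_range hρ_mono u _ hu (by positivity))
    (inner_int γ hγ0 ρ hρ_range hρ_mono u _ hu (by positivity)) measurableSet_Ioc
  intro v hv
  have hv0 : 0 < v := hv.1
  apply hρ_mono
  · simp only [mem_Ici]; positivity
  · simp only [mem_Ici]; positivity
  · gcongr

lemma hrad_nonneg (d : ℕ) (γ : ℝ) (ρ : ℝ → ℝ)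
    (hρ_range : ∀ x : ℝ, 0 ≤ x → 0 ≤ ρ x ∧ ρ x ≤ 1) (u : ℝ) (hu : 0 < u) (r : ℝ) (hr : 0 ≤ r) :
    0 ≤ hrad d γ u ρ r := by
  apply setIntegral_nonneg measurableSet_Ioc
  intro v hv
  have hv0 : 0 < v := hv.1
  exact (hρ_range _ (by positivity)).1

lemma tail_bd (d : ℕ) (hd : 1 ≤ d) (γ δ : ℝ) (hγ0 : 0 < γ) (hγ1 : γ < 1) (hδ : δ = 1 / γ)
    (ρ : ℝ → ℝ) (c C : ℝ) (hc : 0 < c)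
    (hρ_range : ∀ x : ℝ, 0 ≤ x → 0 ≤ ρ x ∧ ρ x ≤ 1)
    (hρ_mono : AntitoneOn ρ (Ici (0 : ℝ)))
    (hρ_bound : ∀ x : ℝ, 1 ≤ x → c * x ^ (-δ) ≤ ρ x ∧ ρ x ≤ C * x ^ (-δ))
    (u R : ℝ) (hu : 0 < u) (hR : 0 < R) (hs : 1 ≤ u * R ^ ((d:ℝ) * δ)) :
    IntegrableOn (fun r => r ^ (d - 1) * hrad d γ u ρ r) (Ioi R) ∧
    c / (d * (δ - 1)) *
      (u⁻¹ * R ^ ((d : ℝ) * (1 - δ)) * (1 + log (u * R ^ ((d:ℝ) * δ)))) ≤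
      ∫ r in Ioi R, r ^ (d - 1) * hrad d γ u ρ r ∧
    ∫ r in Ioi R, r ^ (d - 1) * hrad d γ u ρ r ≤
      max C 1 * (1 + 2 * δ / (δ - 1)) * (2 / (d * (δ - 1))) *
      (u⁻¹ * R ^ ((d : ℝ) * (1 - δ)) * (1 + log (u * R ^ ((d:ℝ) * δ)))) := by
  have hδone : 1 < δ := by rw [hδ]; exact (one_lt_div hγ0).2 hγ1
  have hd0 : (0:ℝ) < d := by exact_mod_cast hd
  have hda : 0 < (d:ℝ) * (δ - 1) := mul_pos hd0 (sub_pos.2 hδone)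
  have hC1 : 0 < max C 1 := lt_max_of_lt_right one_pos
  have hL : 0 ≤ log (u * R ^ ((d:ℝ) * δ)) := log_nonneg hs
  have pt : ∀ r ∈ Ioi R,
      c * (u⁻¹ * (1 + log (u * R ^ ((d:ℝ) * δ)))) * r ^ ((d:ℝ) * (1 - δ) - 1) ≤
        r ^ (d - 1) * hrad d γ u ρ r ∧
      r ^ (d - 1) * hrad d γ u ρ r ≤ max C 1 * ((1 + 2 * δ / (δ - 1)) *
        (u⁻¹ * (1 + log (u * R ^ ((d:ℝ) * δ))) *
        R ^ ((d:ℝ) * (1 - δ) / 2))) * r ^ ((d:ℝ) * (1 - δ) / 2 - 1) := by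
    intro r hr
    have hr' : R < r := hr
    have hr0 : 0 < r := hR.trans hr'
    obtain ⟨d1, d2⟩ := dens_bd d hd δ hδone u R r hu hR hr'.le hs
    have hsr : 1 ≤ u * (r ^ d) ^ δ := by
      rw [← Real.rpow_natCast_mul hr0.le]
      refine hs.trans ?_
      gcongr
    obtain ⟨i1, i2⟩ := inner_bd γ δ hγ0 hγ1 hδ ρ c C hρ_range hρ_mono hρ_bound u (r ^ d) hu
      (by positivity) hsr
    rw [← Real.rpow_natCast_mul hr0.le] at i1 i2
    change _ ≤ hrad d γ u ρ r at i1
    change hrad d γ u ρ r ≤ _ at i2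
    have hp : 0 ≤ r ^ (d - 1) := by positivity
    have j1 := mul_le_mul_of_nonneg_left i1 hp
    have j2 := mul_le_mul_of_nonneg_left i2 hp
    have k1 := mul_le_mul_of_nonneg_left d1 hc.le
    have k2 := mul_le_mul_of_nonneg_left d2 hC1.le
    constructor
    · linarith
    · linarith
  have hlt1 : (d:ℝ) * (1 - δ) - 1 < -1 := by nlinarith
  have hlt2 : (d:ℝ) * (1 - δ) / 2 - 1 < -1 := by nlinarith
  have hi1 := (integrableOn_Ioi_rpow_of_lt hlt1 hR).const_mul
    (c * (u⁻¹ * (1 + log (u * R ^ ((d:ℝ) * δ)))))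
  have hi2 := (integrableOn_Ioi_rpow_of_lt hlt2 hR).const_mul
    (max C 1 * ((1 + 2 * δ / (δ - 1)) *
        (u⁻¹ * (1 + log (u * R ^ ((d:ℝ) * δ))) * R ^ ((d:ℝ) * (1 - δ) / 2))))
  have hm : AEStronglyMeasurable (fun r => r ^ (d - 1) * hrad d γ u ρ r)
      (volume.restrict (Ioi R)) := by
    apply AEStronglyMeasurable.mul
    · exact (by fun_prop : Measurable (fun r : ℝ => r ^ (d - 1))).aestronglyMeasurable
    · apply AEMeasurable.aestronglyMeasurable
      apply aemeasurable_restrict_of_antitoneOn measurableSet_Ioi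
      exact (hrad_anti d γ hγ0 ρ hρ_range hρ_mono u hu).mono
        (fun x hx => (hR.trans hx).le)
  have hi : IntegrableOn (fun r => r ^ (d - 1) * hrad d γ u ρ r) (Ioi R) := by
    apply Integrable.mono' hi2 hm
    filter_upwards [ae_restrict_mem measurableSet_Ioi] with r hr
    have hr0 : 0 < r := hR.trans hr
    rw [Real.norm_of_nonneg
      (mul_nonneg (by positivity) (hrad_nonneg d γ ρ hρ_range u hu r hr0.le))]
    exact (pt r hr).2
  refine ⟨hi, ?_, ?_⟩
  · refine le_trans (le_of_eq ?_)
      (setIntegral_mono_on hi1 hi measurableSet_Ioi (fun r hr => (pt r hr).1))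
    rw [integral_const_mul, integral_Ioi_rpow_of_lt hlt1 hR, sub_add_cancel]
    have : (d:ℝ) * (1 - δ) = - (d * (δ - 1)) := by ring
    rw [this, neg_div_neg_eq]
    ring
  · refine le_trans
      (setIntegral_mono_on hi hi2 measurableSet_Ioi (fun r hr => (pt r hr).2)) (le_of_eq ?_)
    rw [integral_const_mul, integral_Ioi_rpow_of_lt hlt2 hR, sub_add_cancel]
    have e : R ^ ((d:ℝ) * (1 - δ)) = R ^ ((d:ℝ) * (1 - δ) / 2) * R ^ ((d:ℝ) * (1 - δ) / 2) := by
      rw [← Real.rpow_add hR]; congr 1; ring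
    rw [e]
    have : (d:ℝ) * (1 - δ) / 2 = - (d * (δ - 1) / 2) := by ring
    rw [this, neg_div_neg_eq]
    field_simp

lemma polar (d : ℕ) (hd : 1 ≤ d) (h : ℝ → ℝ) (R : ℝ) (hR : 0 < R) :
    ∫ x in {x : EuclideanSpace ℝ (Fin d) | R ≤ ‖x‖}, h ‖x‖ =
      (d * volume.real (Metric.ball (0 : EuclideanSpace ℝ (Fin d)) 1)) *
        ∫ r in Ioi R, r ^ (d - 1) * h r := by
  have : Nonempty (Fin d) := ⟨⟨0, hd⟩⟩
  have hms : MeasurableSet {x : EuclideanSpace ℝ (Fin d) | R ≤ ‖x‖} :=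
    measurableSet_le measurable_const measurable_norm
  rw [← integral_indicator hms]
  have : ({x : EuclideanSpace ℝ (Fin d) | R ≤ ‖x‖}.indicator fun x => h ‖x‖) =
      fun x => (Ici R).indicator h ‖x‖ := by
    ext x; simp [indicator]
  rw [this, integral_fun_norm_addHaar]
  simp only [finrank_euclideanSpace, Fintype.card_fin, smul_eq_mul, nsmul_eq_mul]
  rw [← mul_assoc]
  congr 1
  rw [← integral_Ici_eq_integral_Ioi]
  have : (fun y : ℝ => y ^ (d - 1) * (Ici R).indicator h y) =
      (Ici R).indicator (fun r => r ^ (d - 1) * h r) := by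
    ext y; simp [indicator]
  rw [this, setIntegral_indicator measurableSet_Ici, ← integral_Ici_eq_integral_Ioi]
  congr 2
  exact inter_eq_right.2 (Ici_subset_Ici.2 hR.le)


/-- One-edge escape probability asymptotics for a soft profile in the boundary regime
`δ = 1/γ`: the expected number of direct connections of a vertex with mark `u` at the
origin to vertices outside `B(0,R)`, truncated at 1, is of order
`min(u⁻¹ R^{d(1-δ)} (1 + log₊(u R^{dδ})), 1)`. -/
theorem stmt_3 (d : ℕ) (hd : 1 ≤ d) (γ δ : ℝ) (hγ0 : 0 < γ) (hγ1 : γ < 1)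
    (hδ : δ = 1 / γ)
    (ρ : ℝ → ℝ) (c C : ℝ) (hc : 0 < c) (hcC : c ≤ C)
    (hρ_range : ∀ x : ℝ, 0 ≤ x → 0 ≤ ρ x ∧ ρ x ≤ 1)
    (hρ_mono : AntitoneOn ρ (Ici (0 : ℝ)))
    (hρ_bound : ∀ x : ℝ, 1 ≤ x → c * x ^ (-δ) ≤ ρ x ∧ ρ x ≤ C * x ^ (-δ)) :
    ∃ c' C' : ℝ, 0 < c' ∧ c' ≤ C' ∧ ∀ u R : ℝ, u ∈ Ioc (0 : ℝ) 1 → 2 ≤ R →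
      c' * min (u⁻¹ * R ^ ((d : ℝ) * (1 - δ)) *
            (1 + max (Real.log (u * R ^ ((d : ℝ) * δ))) 0)) 1 ≤
          min (∫ x in {x : EuclideanSpace ℝ (Fin d) | R ≤ ‖x‖},
              ∫ v in Ioc (0 : ℝ) 1, ρ (‖x‖ ^ d * (u * v) ^ γ)) 1 ∧
      min (∫ x in {x : EuclideanSpace ℝ (Fin d) | R ≤ ‖x‖},
              ∫ v in Ioc (0 : ℝ) 1, ρ (‖x‖ ^ d * (u * v) ^ γ)) 1 ≤
          C' * min (u⁻¹ * R ^ ((d : ℝ) * (1 - δ)) *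
            (1 + max (Real.log (u * R ^ ((d : ℝ) * δ))) 0)) 1 := by
  have hδone : 1 < δ := by rw [hδ]; exact (one_lt_div hγ0).2 hγ1
  have hd0 : (0:ℝ) < d := by exact_mod_cast hd
  have hda : 0 < (d:ℝ) * (δ - 1) := mul_pos hd0 (sub_pos.2 hδone)
  have hω : 0 < volume.real (Metric.ball (0 : EuclideanSpace ℝ (Fin d)) 1) :=
    ENNReal.toReal_pos (Metric.measure_ball_pos _ _ one_pos).ne' measure_ball_lt_top.ne
  set W := (d * volume.real (Metric.ball (0 : EuclideanSpace ℝ (Fin d)) 1)) with hW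
  have hW0 : 0 < W := by positivity
  set m := W * (c / (d * (δ - 1))) with hm
  have hm0 : 0 < m := by positivity
  set M := W * (max C 1 * (1 + 2 * δ / (δ - 1)) * (2 / (d * (δ - 1)))) with hM
  refine ⟨min m 1, max M 1, lt_min hm0 one_pos, (min_le_right _ _).trans (le_max_right _ _), ?_⟩
  intro u R hu hR2
  have hu0 : 0 < u := hu.1
  have hR : 0 < R := by linarith
  have hpol := polar d hd (hrad d γ u ρ) R hR
  rw [← hW] at hpol
  change ∫ x in {x : EuclideanSpace ℝ (Fin d) | R ≤ ‖x‖},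
              ∫ v in Ioc (0 : ℝ) 1, ρ (‖x‖ ^ d * (u * v) ^ γ) = _ at hpol
  rw [hpol]
  set J := ∫ r in Ioi R, r ^ (d - 1) * hrad d γ u ρ r with hJ
  rcases le_or_gt 1 (u * R ^ ((d:ℝ) * δ)) with hs | hs
  · obtain ⟨_, h2, h3⟩ := tail_bd d hd γ δ hγ0 hγ1 hδ ρ c C hc hρ_range hρ_mono hρ_bound u R hu0 hR hs
    have hL : 0 ≤ log (u * R ^ ((d:ℝ) * δ)) := log_nonneg hs
    rw [max_eq_left hL]
    set X := u⁻¹ * R ^ ((d : ℝ) * (1 - δ)) * (1 + log (u * R ^ ((d:ℝ) * δ))) with hX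
    have hX0 : 0 ≤ X := by positivity
    have h2' : m * X ≤ W * J := by
      have := mul_le_mul_of_nonneg_left h2 hW0.le
      rw [hm]; linarith
    have h3' : W * J ≤ M * X := by
      have := mul_le_mul_of_nonneg_left h3 hW0.le
      rw [hM]; linarith
    have hX1 : 0 ≤ min X 1 := le_min hX0 zero_le_one
    constructor
    · apply le_min
      · calc min m 1 * min X 1 ≤ m * X :=
            mul_le_mul (min_le_left _ _) (min_le_left _ _) hX1 hm0.le
          _ ≤ _ := h2'
      · calc min m 1 * min X 1 ≤ 1 * 1 :=
            mul_le_mul (min_le_right _ _) (min_le_right _ _) hX1 zero_le_one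
          _ = 1 := by ring
    · have hp : 0 ≤ max M 1 := zero_le_one.trans (le_max_right _ _)
      rw [mul_min_of_nonneg _ _ hp]
      apply le_min
      · exact (min_le_left _ _).trans (h3'.trans
          (mul_le_mul_of_nonneg_right (le_max_left _ _) hX0))
      · rw [mul_one]
        exact (min_le_right _ _).trans (le_max_right _ _)
  · have hp : 0 < u * R ^ ((d:ℝ) * δ) := by positivity
    rw [max_eq_right (Real.log_nonpos hp.le hs.le), add_zero, mul_one]
    have hRd : 1 ≤ R ^ d := one_le_pow₀ (by linarith)
    have hX : 1 ≤ u⁻¹ * R ^ ((d : ℝ) * (1 - δ)) := by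
      have e : u⁻¹ * R ^ ((d : ℝ) * (1 - δ)) = R ^ d * (u * R ^ ((d:ℝ) * δ))⁻¹ := by
        rw [mul_sub, mul_one, Real.rpow_sub hR, Real.rpow_natCast]
        field_simp
      rw [e]
      exact one_le_mul_of_one_le_of_one_le hRd ((one_le_inv₀ hp).2 hs.le)
    rw [min_eq_right hX, mul_one, mul_one]
    refine ⟨?_, (min_le_right _ _).trans (le_max_right _ _)⟩
    refine le_min ((min_le_left _ _).trans ?_) (min_le_right _ _)
    have hdδ : 0 < (d:ℝ) * δ := by positivity
    obtain ⟨r0, hr0, hr0e⟩ : ∃ r0 : ℝ, 0 < r0 ∧ r0 ^ ((d:ℝ) * δ) = u⁻¹ := by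
      refine ⟨(u⁻¹) ^ ((d:ℝ) * δ)⁻¹, by positivity, ?_⟩
      exact Real.rpow_inv_rpow (by positivity) hdδ.ne'
    have hRr : R ≤ r0 := by
      rw [← Real.rpow_le_rpow_iff hR.le hr0.le hdδ, hr0e, ← one_div, le_div_iff₀' hu0]
      exact hs.le
    have hs0 : u * r0 ^ ((d:ℝ) * δ) = 1 := by rw [hr0e]; field_simp
    obtain ⟨h1, h2, _⟩ := tail_bd d hd γ δ hγ0 hγ1 hδ ρ c C hc hρ_range hρ_mono hρ_bound u r0 hu0
      hr0 hs0.ge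
    rw [hs0, log_one, add_zero, mul_one, ← hr0e, ← Real.rpow_add hr0] at h2
    have e : (d:ℝ) * δ + d * (1 - δ) = d := by ring
    rw [e, Real.rpow_natCast] at h2
    have hr1 : 1 ≤ r0 ^ d := one_le_pow₀ (by linarith)
    have hint : IntegrableOn (fun r => r ^ (d - 1) * hrad d γ u ρ r) (Ioi R) := by
      rw [← Ioc_union_Ioi_eq_Ioi hRr]
      refine IntegrableOn.union ?_ h1
      apply IntegrableOn.mono_set (t := Icc R r0) _ Ioc_subset_Icc_self
      apply IntegrableOn.continuousOn_mul (by fun_prop) _ isCompact_Icc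
      apply AntitoneOn.integrableOn_isCompact isCompact_Icc
      exact (hrad_anti d γ hγ0 ρ hρ_range hρ_mono u hu0).mono (fun x hx => hR.le.trans hx.1)
    have h3 : ∫ r in Ioi r0, r ^ (d - 1) * hrad d γ u ρ r ≤ J := by
      apply setIntegral_mono_set hint
      · filter_upwards [ae_restrict_mem measurableSet_Ioi] with r hr
        have hr' : 0 < r := hR.trans hr
        exact mul_nonneg (by positivity) (hrad_nonneg d γ ρ hρ_range u hu0 r hr'.le)
      · exact (Ioi_subset_Ioi hRr).eventuallyLE
    rw [hm]
    apply mul_le_mul_of_nonneg_left _ hW0.le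
    refine le_trans ?_ (h2.trans h3)
    exact le_mul_of_one_le_right (by positivity) hr1
end

section
/- Let d ≥ 1 be an integer and let 0 < γ < 1/2. Then there exist R₀ ≥ 4 and constants 0 < c' ≤ C' < ∞ (depending only on d and γ) such that for all r ≥ 2 and all R ≥ max(8r, R₀) one has c'·r^{dγ}·R^{d(2−γ−1/γ)} ≤ ∫_{{x ∈ ℝ^d : 2r ≤ |x| ≤ R/2}} ∫_0^1 min(v^{−1} r^d |x|^{−d/γ}, 1) · min(v^{−1} R^{d(1−1/γ)}, 1) dv dx ≤ C'·r^{dγ}·R^{d(2−γ−1/γ)}. -/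
open MeasureTheory Real Set

lemma aux_J (p q : ℝ) (hp : -1 < p) (hq : q < -1) :
    IntegrableOn (fun y : ℝ => min (y ^ p) (y ^ q)) (Ioi 0) := by
  have hm : Measurable (fun y : ℝ => min (y ^ p) (y ^ q)) := by fun_prop
  rw [← Ioc_union_Ioi_eq_Ioi (zero_le_one' ℝ)]
  refine IntegrableOn.union ?_ ?_
  · have h1 : IntegrableOn (fun y : ℝ => y ^ p) (Ioc 0 1) := by
      have := intervalIntegral.intervalIntegrable_rpow' (a := 0) (b := 1) hp
      rwa [intervalIntegrable_iff_integrableOn_Ioc_of_le zero_le_one] at this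
    refine Integrable.mono' h1 hm.aestronglyMeasurable ?_
    filter_upwards [ae_restrict_mem measurableSet_Ioc] with y hy
    have h0 : 0 < y := hy.1
    rw [Real.norm_of_nonneg (by positivity)]
    exact min_le_left _ _
  · refine Integrable.mono' (integrableOn_Ioi_rpow_of_lt hq zero_lt_one)
      hm.aestronglyMeasurable ?_
    filter_upwards [ae_restrict_mem measurableSet_Ioi] with y hy
    have h0 : 0 < y := lt_trans zero_lt_one hy
    rw [Real.norm_of_nonneg (by positivity)]
    exact min_le_right _ _

lemma aux_inner (θ : ℝ) (h0 : 0 < θ) (h1 : θ < 1) :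
    ∃ K : ℝ, 0 ≤ K ∧ ∀ t b : ℝ, 0 < t → 0 < b →
      (∫ v in Ioc (0 : ℝ) 1, min (v⁻¹ * (b * t)) 1 * min (v⁻¹ * b) 1) ≤ K * (b * t ^ θ) := by
  have hJ := aux_J (-θ) (-θ - 1) (by linarith) (by linarith)
  refine ⟨∫ y in Ioi (0:ℝ), min (y ^ (-θ)) (y ^ (-θ - 1)), ?_, ?_⟩
  · refine setIntegral_nonneg measurableSet_Ioi fun y hy => ?_
    have : 0 < y := hy
    positivity
  intro t b ht hb
  have hI : IntegrableOn (fun v : ℝ => t ^ θ *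
      min ((b⁻¹ * v) ^ (-θ)) ((b⁻¹ * v) ^ (-θ - 1))) (Ioi 0) := by
    apply Integrable.const_mul
    have := (integrableOn_Ioi_comp_mul_left_iff
      (fun y : ℝ => min (y ^ (-θ)) (y ^ (-θ - 1))) 0 (inv_pos.2 hb)).2 (by simpa using hJ)
    exact this
  have hE : ∫ v in Ioi (0:ℝ), t ^ θ * min ((b⁻¹ * v) ^ (-θ)) ((b⁻¹ * v) ^ (-θ - 1))
      = t ^ θ * (b * ∫ y in Ioi (0:ℝ), min (y ^ (-θ)) (y ^ (-θ - 1))) := by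
    rw [integral_const_mul]
    have := integral_comp_mul_left_Ioi
      (fun y : ℝ => min (y ^ (-θ)) (y ^ (-θ - 1))) 0 (inv_pos.2 hb)
    simp only [mul_zero, inv_inv, smul_eq_mul] at this
    rw [this]
  calc _ ≤ ∫ v in Ioc (0:ℝ) 1, t ^ θ * min ((b⁻¹ * v) ^ (-θ)) ((b⁻¹ * v) ^ (-θ - 1)) := by
        refine integral_mono_of_nonneg ?_ (hI.mono_set Ioc_subset_Ioi_self) ?_
        · filter_upwards [ae_restrict_mem measurableSet_Ioc] with v hv
          have : 0 < v := hv.1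
          simp only [Pi.zero_apply]
          positivity
        · filter_upwards [ae_restrict_mem measurableSet_Ioc] with v hv
          have hv0 : 0 < v := hv.1
          have hw : 0 < b⁻¹ * v := by positivity
          have e1 : v⁻¹ * (b * t) = (b⁻¹ * v)⁻¹ * t := by field_simp
          have e2 : v⁻¹ * b = (b⁻¹ * v)⁻¹ := by field_simp
          simp only [e1, e2]
          generalize b⁻¹ * v = w at hw
          have e3 : min (w ^ (-θ)) (w ^ (-θ - 1)) = w ^ (-θ) * min w⁻¹ 1 := by
            rw [mul_min_of_nonneg _ _ (by positivity), min_comm, sub_eq_add_neg,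
              Real.rpow_add hw, Real.rpow_neg_one, mul_one]
          rw [e3, ← mul_assoc]
          refine mul_le_mul_of_nonneg_right ?_ (by positivity)
          have e4 : t ^ θ * w ^ (-θ) = (w⁻¹ * t) ^ θ := by
            rw [Real.mul_rpow (by positivity) ht.le, Real.inv_rpow hw.le, Real.rpow_neg hw.le,
              mul_comm]
          rw [e4]
          have hz : 0 < w⁻¹ * t := by positivity
          rcases le_total (w⁻¹ * t) 1 with h | h
          · refine (min_le_left _ _).trans ?_
            exact Real.self_le_rpow_of_le_one hz.le h h1.le
          · exact (min_le_right _ _).trans (Real.one_le_rpow h h0.le)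
    _ ≤ ∫ v in Ioi (0:ℝ), t ^ θ * min ((b⁻¹ * v) ^ (-θ)) ((b⁻¹ * v) ^ (-θ - 1)) := by
        refine setIntegral_mono_set hI ?_ Ioc_subset_Ioi_self.eventuallyLE
        filter_upwards [ae_restrict_mem measurableSet_Ioi] with v hv
        have : 0 < v := hv
        simp only [Pi.zero_apply]
        positivity
    _ = _ := by rw [hE]; ring

lemma aux_G (d : ℕ) (hd : 1 ≤ d) :
    Integrable (fun x : EuclideanSpace ℝ (Fin d) =>
      min (‖x‖ ^ (-((d:ℝ) / 2))) (‖x‖ ^ (-(2 * (d:ℝ))))) := by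
  have : Nonempty (Fin d) := ⟨⟨0, hd⟩⟩
  have hd' : (1:ℝ) ≤ d := by exact_mod_cast hd
  have := (integrable_fun_norm_addHaar (volume : Measure (EuclideanSpace ℝ (Fin d)))
    (f := fun y : ℝ => min (y ^ (-((d:ℝ) / 2))) (y ^ (-(2 * (d:ℝ)))))).2 ?_
  · exact this
  refine (aux_J ((d:ℝ) / 2 - 1) (-(d:ℝ) - 1) (by linarith) (by linarith)).congr_fun ?_
    measurableSet_Ioi
  intro y hy
  have hy0 : 0 < y := hy
  simp only [finrank_euclideanSpace, Fintype.card_fin, smul_eq_mul]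
  rw [mul_min_of_nonneg _ _ (by positivity), ← Real.rpow_natCast, Nat.cast_sub hd,
    ← Real.rpow_add hy0, ← Real.rpow_add hy0]
  congr 2 <;> push_cast <;> ring

lemma aux_vol (d : ℕ) (hd : 1 ≤ d) (u s : ℝ) (hu : 0 < u) (hus : u ≤ 5 / 7 * s) :
    2 / 7 * s ^ d * (volume : Measure (EuclideanSpace ℝ (Fin d))).real (Metric.ball 0 1) ≤
      (volume : Measure (EuclideanSpace ℝ (Fin d))).real {x | u ≤ ‖x‖ ∧ ‖x‖ ≤ s} := by
  have hs : 0 < s := by linarith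
  have : Nonempty (Fin d) := ⟨⟨0, hd⟩⟩
  have e : {x : EuclideanSpace ℝ (Fin d) | u ≤ ‖x‖ ∧ ‖x‖ ≤ s} =
      Metric.closedBall 0 s \ Metric.ball 0 u := by
    ext x; simp [and_comm]
  rw [e, measureReal_sdiff (Metric.ball_subset_closedBall.trans
    (Metric.closedBall_subset_closedBall (by linarith))) measurableSet_ball measure_closedBall_lt_top.ne]
  simp only [Measure.real]
  rw [Measure.addHaar_closedBall _ _ hs.le, Measure.addHaar_ball _ _ hu.le,
    ENNReal.toReal_mul, ENNReal.toReal_mul, ENNReal.toReal_ofReal (by positivity),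
    ENNReal.toReal_ofReal (by positivity), finrank_euclideanSpace, Fintype.card_fin, ← sub_mul]
  refine mul_le_mul_of_nonneg_right ?_ ENNReal.toReal_nonneg
  have h1 : u ^ d ≤ (5 / 7 * s) ^ d := pow_le_pow_left₀ hu.le hus d
  have h2 : ((5:ℝ) / 7) ^ d ≤ 5 / 7 := pow_le_of_le_one (by norm_num) (by norm_num) (by omega)
  rw [mul_pow] at h1
  have h3 : 0 < s ^ d := by positivity
  nlinarith

lemma aux_int (d : ℕ) (a : ℝ → ℝ) (ha : Measurable a) (b u s : ℝ) (hb : 0 < b)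
    (ha0 : ∀ y, 0 ≤ y → 0 ≤ a y) :
    IntegrableOn (fun x : EuclideanSpace ℝ (Fin d) =>
      ∫ v in Ioc (0 : ℝ) 1, min (v⁻¹ * a ‖x‖) 1 * min (v⁻¹ * b) 1)
      {x | u ≤ ‖x‖ ∧ ‖x‖ ≤ s} := by
  have hm : StronglyMeasurable (fun x : EuclideanSpace ℝ (Fin d) =>
      ∫ v in Ioc (0 : ℝ) 1, min (v⁻¹ * a ‖x‖) 1 * min (v⁻¹ * b) 1) := by
    apply StronglyMeasurable.integral_prod_right'
      (f := fun p : EuclideanSpace ℝ (Fin d) × ℝ =>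
        min (p.2⁻¹ * a ‖p.1‖) 1 * min (p.2⁻¹ * b) 1)
    apply Measurable.stronglyMeasurable
    fun_prop
  refine IntegrableOn.of_bound (C := 1) ?_ hm.aestronglyMeasurable ?_
  · refine lt_of_le_of_lt (measure_mono (t := Metric.closedBall 0 s) ?_)
      measure_closedBall_lt_top
    intro x hx
    simpa using hx.2
  · refine Filter.Eventually.of_forall fun x => ?_
    refine (norm_setIntegral_le_of_norm_le_const (C := 1) (by simp) ?_).trans (by simp)
    intro v hv
    have : 0 < v := hv.1
    have h2 := ha0 _ (norm_nonneg x)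
    rw [Real.norm_of_nonneg (by positivity)]
    exact mul_le_one₀ (min_le_right _ _) (by positivity) (min_le_right _ _)

/-- Two-edge annulus crossing integral in the regime `δ > 1/γ`: for `2 ≤ r` and
`R ≥ max(8r, R₀)`,
`∫_{2r ≤ |x| ≤ R/2} ∫_0^1 min(v⁻¹ r^d |x|^{-d/γ}, 1) min(v⁻¹ R^{d(1-1/γ)}, 1) dv dx
  ≍ r^{dγ} R^{d(2-γ-1/γ)}`. -/
theorem stmt_16 (d : ℕ) (hd : 1 ≤ d) (γ : ℝ) (hγ0 : 0 < γ) (hγ1 : γ < 1 / 2) :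
    ∃ R₀ : ℝ, 4 ≤ R₀ ∧ ∃ c' C' : ℝ, 0 < c' ∧ c' ≤ C' ∧
      ∀ r R : ℝ, 2 ≤ r → max (8 * r) R₀ ≤ R →
      c' * (r ^ ((d : ℝ) * γ) * R ^ ((d : ℝ) * (2 - γ - 1 / γ))) ≤
          (∫ x in {x : EuclideanSpace ℝ (Fin d) | 2 * r ≤ ‖x‖ ∧ ‖x‖ ≤ R / 2},
              ∫ v in Ioc (0 : ℝ) 1,
                min (v⁻¹ * r ^ d * ‖x‖ ^ (-((d : ℝ) / γ))) 1 *
                  min (v⁻¹ * R ^ ((d : ℝ) * (1 - 1 / γ))) 1) ∧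
      (∫ x in {x : EuclideanSpace ℝ (Fin d) | 2 * r ≤ ‖x‖ ∧ ‖x‖ ≤ R / 2},
              ∫ v in Ioc (0 : ℝ) 1,
                min (v⁻¹ * r ^ d * ‖x‖ ^ (-((d : ℝ) / γ))) 1 *
                  min (v⁻¹ * R ^ ((d : ℝ) * (1 - 1 / γ))) 1) ≤
          C' * (r ^ ((d : ℝ) * γ) * R ^ ((d : ℝ) * (2 - γ - 1 / γ))) := by
  have hd' : (1:ℝ) ≤ d := by exact_mod_cast hd
  obtain ⟨K1, hK1, hI1⟩ := aux_inner (γ / 2) (by linarith) (by linarith)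
  obtain ⟨K2, hK2, hI2⟩ := aux_inner (2 * γ) (by linarith) (by linarith)
  set L : ℝ := ∫ x : EuclideanSpace ℝ (Fin d),
      min (‖x‖ ^ (-((d:ℝ) / 2))) (‖x‖ ^ (-(2 * (d:ℝ)))) with hL
  set ω : ℝ := (volume : Measure (EuclideanSpace ℝ (Fin d))).real (Metric.ball 0 1) with hω
  have hω0 : 0 < ω := by
    rw [hω, Measure.real]
    exact ENNReal.toReal_pos (Metric.measure_ball_pos _ _ one_pos).ne' measure_ball_lt_top.ne
  set c : ℝ := 2 / 7 * (1 / 2) ^ d * ω with hc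
  have hc0 : 0 < c := by positivity
  refine ⟨4, le_rfl, c, max c ((K1 + K2) * L), hc0, le_max_left _ _, ?_⟩
  intro r R hr hR
  have hR8 : 8 * r ≤ R := (le_max_left _ _).trans hR
  have hr0 : 0 < r := by linarith
  have hR0 : 0 < R := by linarith
  set b : ℝ := R ^ ((d : ℝ) * (1 - 1 / γ)) with hb
  have hb0 : 0 < b := by positivity
  have hγi : 1 < 1 / γ := by rw [lt_div_iff₀ hγ0]; linarith
  have hb1 : b ≤ 1 := by
    apply Real.rpow_le_one_of_one_le_of_nonpos (by linarith)
    nlinarith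
  set ρ : ℝ := r ^ γ * R ^ (1 - γ) with hρ
  have hρ0 : 0 < ρ := by positivity
  have hρR : ρ ≤ R := by
    calc ρ ≤ R ^ γ * R ^ (1 - γ) := by
          refine mul_le_mul_of_nonneg_right ?_ (by positivity)
          exact Real.rpow_le_rpow hr0.le (by linarith) hγ0.le
      _ = R := by rw [← Real.rpow_add hR0]; simp
  have hρr : 14 / 5 * r ≤ ρ := by
    have h8 : (14 / 5 : ℝ) ≤ 8 ^ (1 - γ) := by
      calc (14 / 5 : ℝ) ≤ 8 ^ (1 / 2 : ℝ) := by
            rw [← Real.sqrt_eq_rpow]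
            exact Real.le_sqrt_of_sq_le (by norm_num)
        _ ≤ _ := Real.rpow_le_rpow_of_exponent_le (by norm_num) (by linarith)
    calc 14 / 5 * r ≤ 8 ^ (1 - γ) * r := by nlinarith
      _ = r ^ γ * (8 * r) ^ (1 - γ) := by
          rw [Real.mul_rpow (by norm_num) hr0.le]
          have : r = r ^ γ * r ^ (1 - γ) := by rw [← Real.rpow_add hr0]; simp
          nth_rewrite 1 [this]; ring
      _ ≤ ρ := by
          refine mul_le_mul_of_nonneg_left ?_ (by positivity)
          exact Real.rpow_le_rpow (by linarith) hR8 (by linarith)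
  have hmain : r ^ ((d : ℝ) * γ) * R ^ ((d : ℝ) * (2 - γ - 1 / γ)) = b * ρ ^ d := by
    rw [hb, hρ, mul_pow, ← Real.rpow_natCast, ← Real.rpow_natCast, ← Real.rpow_mul hr0.le,
      ← Real.rpow_mul hR0.le, mul_left_comm, ← Real.rpow_add hR0]
    congr 2 <;> ring
  have ha : ∀ y : ℝ, 0 < y → r ^ d * y ^ (-((d : ℝ) / γ)) = b * (ρ⁻¹ * y) ^ (-((d : ℝ) / γ)) := by
    intro y hy
    rw [Real.mul_rpow (by positivity) hy.le, ← mul_assoc]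
    congr 1
    rw [Real.inv_rpow hρ0.le, Real.rpow_neg hρ0.le, inv_inv, hb, hρ,
      Real.mul_rpow (by positivity) (by positivity), ← Real.rpow_mul hr0.le,
      ← Real.rpow_mul hR0.le, mul_left_comm, ← Real.rpow_add hR0, ← Real.rpow_natCast]
    have e1 : γ * ((d:ℝ) / γ) = d := by field_simp
    have e2 : (d:ℝ) * (1 - 1 / γ) + (1 - γ) * ((d:ℝ) / γ) = 0 := by field_simp; ring
    rw [e1, e2]; simp
  rw [hmain]
  simp only [mul_assoc _ (r ^ d) _]
  have hS : MeasurableSet {x : EuclideanSpace ℝ (Fin d) | 2 * r ≤ ‖x‖ ∧ ‖x‖ ≤ R / 2} :=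
    (measurableSet_le measurable_const measurable_norm).inter
      (measurableSet_le measurable_norm measurable_const)
  have hInt := aux_int d (fun y => r ^ d * y ^ (-((d : ℝ) / γ))) (by fun_prop) b (2 * r) (R / 2)
    hb0 (fun y hy => by positivity)
  have hpos : ∀ x : EuclideanSpace ℝ (Fin d), 0 ≤ ∫ v in Ioc (0 : ℝ) 1,
      min (v⁻¹ * (r ^ d * ‖x‖ ^ (-((d : ℝ) / γ)))) 1 * min (v⁻¹ * b) 1 := by
    intro x
    refine setIntegral_nonneg measurableSet_Ioc fun v hv => ?_
    have : 0 < v := hv.1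
    positivity
  constructor
  · set s : ℝ := min ρ (R / 2) with hs
    have hsub : {x : EuclideanSpace ℝ (Fin d) | 2 * r ≤ ‖x‖ ∧ ‖x‖ ≤ s} ⊆
        {x | 2 * r ≤ ‖x‖ ∧ ‖x‖ ≤ R / 2} := fun x hx => ⟨hx.1, hx.2.trans (min_le_right _ _)⟩
    have hS' : MeasurableSet {x : EuclideanSpace ℝ (Fin d) | 2 * r ≤ ‖x‖ ∧ ‖x‖ ≤ s} :=
      (measurableSet_le measurable_const measurable_norm).inter
        (measurableSet_le measurable_norm measurable_const)
    have hfin : volume {x : EuclideanSpace ℝ (Fin d) | 2 * r ≤ ‖x‖ ∧ ‖x‖ ≤ s} ≠ ⊤ := by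
      refine (lt_of_le_of_lt (measure_mono (t := Metric.closedBall 0 s) ?_)
        measure_closedBall_lt_top).ne
      intro x hx
      simpa using hx.2
    have hs1 : 14 / 5 * r ≤ s := le_min hρr (by linarith)
    have hs2 : 1 / 2 * ρ ≤ s := le_min (by linarith) (by linarith)
    have hvol := aux_vol d hd (2 * r) s (by linarith) (by linarith)
    refine le_trans ?_ (setIntegral_mono_set hInt (Filter.Eventually.of_forall hpos)
      hsub.eventuallyLE)
    refine le_trans ?_ (setIntegral_mono_on (f := fun _ => b) (integrableOn_const hfin)
      (hInt.mono_set hsub) hS' ?_)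
    · rw [setIntegral_const, smul_eq_mul, mul_comm _ b, mul_left_comm]
      refine mul_le_mul_of_nonneg_left (le_trans ?_ hvol) hb0.le
      have : (1 / 2 * ρ) ^ d ≤ s ^ d := pow_le_pow_left₀ (by positivity) hs2 d
      rw [mul_pow] at this
      rw [hc, ← hω]
      calc _ = 2 / 7 * ((1 / 2) ^ d * ρ ^ d) * ω := by ring
        _ ≤ _ := by gcongr
    · intro x hx
      have hx0 : 0 < ‖x‖ := by linarith [hx.1]
      have hab : b ≤ r ^ d * ‖x‖ ^ (-((d : ℝ) / γ)) := by
        rw [ha _ hx0]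
        refine le_mul_of_one_le_right hb0.le ?_
        refine Real.one_le_rpow_of_pos_of_le_one_of_nonpos (by positivity) ?_ ?_
        · rw [inv_mul_le_iff₀ hρ0, mul_one]
          exact hx.2.trans (min_le_left _ _)
        · have : 0 < (d:ℝ) / γ := by positivity
          linarith
      have hIv : IntegrableOn (fun v : ℝ =>
          min (v⁻¹ * (r ^ d * ‖x‖ ^ (-((d : ℝ) / γ)))) 1 * min (v⁻¹ * b) 1) (Ioc 0 1) := by
        refine IntegrableOn.of_bound (C := 1) (by simp)
          (Measurable.aestronglyMeasurable (by fun_prop)) ?_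
        filter_upwards [ae_restrict_mem measurableSet_Ioc] with v hv
        have : 0 < v := hv.1
        rw [Real.norm_of_nonneg (by positivity)]
        exact mul_le_one₀ (min_le_right _ _) (by positivity) (min_le_right _ _)
      have hss : Ioc (0:ℝ) b ⊆ Ioc 0 1 := Ioc_subset_Ioc_right hb1
      calc b = ∫ v in Ioc (0:ℝ) b, (1:ℝ) := by simp [hb0.le]
        _ ≤ ∫ v in Ioc (0 : ℝ) b,
            min (v⁻¹ * (r ^ d * ‖x‖ ^ (-((d : ℝ) / γ)))) 1 * min (v⁻¹ * b) 1 := by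
          refine setIntegral_mono_on (integrableOn_const (by simp)) (hIv.mono_set hss)
            measurableSet_Ioc ?_
          intro v hv
          have hv0 : 0 < v := hv.1
          have h1 : 1 ≤ v⁻¹ * b := by
            rw [le_inv_mul_iff₀ hv0, mul_one]; exact hv.2
          have h2 : 1 ≤ v⁻¹ * (r ^ d * ‖x‖ ^ (-((d : ℝ) / γ))) :=
            h1.trans (mul_le_mul_of_nonneg_left hab (by positivity))
          rw [min_eq_right h1, min_eq_right h2, mul_one]
        _ ≤ _ := by
          refine setIntegral_mono_set hIv ?_ hss.eventuallyLE
          filter_upwards [ae_restrict_mem measurableSet_Ioc] with v hv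
          have : 0 < v := hv.1
          simp only [Pi.zero_apply]
          positivity
  · have hG := aux_G d hd
    have hGs : Integrable (fun x : EuclideanSpace ℝ (Fin d) => ((K1 + K2) * b) *
        min (‖ρ⁻¹ • x‖ ^ (-((d:ℝ) / 2))) (‖ρ⁻¹ • x‖ ^ (-(2 * (d:ℝ))))) :=
      (hG.comp_smul (inv_ne_zero hρ0.ne')).const_mul _
    have hGe : ∫ x : EuclideanSpace ℝ (Fin d), ((K1 + K2) * b) *
        min (‖ρ⁻¹ • x‖ ^ (-((d:ℝ) / 2))) (‖ρ⁻¹ • x‖ ^ (-(2 * (d:ℝ)))) =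
        (K1 + K2) * L * (b * ρ ^ d) := by
      rw [integral_const_mul]
      have := Measure.integral_comp_smul (volume : Measure (EuclideanSpace ℝ (Fin d)))
        (fun x => min (‖x‖ ^ (-((d:ℝ) / 2))) (‖x‖ ^ (-(2 * (d:ℝ))))) ρ⁻¹
      rw [this, ← hL, finrank_euclideanSpace, Fintype.card_fin, inv_pow, inv_inv,
        abs_of_pos (by positivity), smul_eq_mul]
      ring
    calc _ ≤ ∫ x in {x : EuclideanSpace ℝ (Fin d) | 2 * r ≤ ‖x‖ ∧ ‖x‖ ≤ R / 2},
          ((K1 + K2) * b) *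
            min (‖ρ⁻¹ • x‖ ^ (-((d:ℝ) / 2))) (‖ρ⁻¹ • x‖ ^ (-(2 * (d:ℝ)))) := by
          refine setIntegral_mono_on hInt hGs.integrableOn hS ?_
          intro x hx
          have hx0 : 0 < ‖x‖ := by linarith [hx.1]
          have hn : ‖ρ⁻¹ • x‖ = ρ⁻¹ * ‖x‖ := by
            rw [norm_smul, Real.norm_of_nonneg (by positivity)]
          have ht : 0 < ρ⁻¹ * ‖x‖ := by positivity
          rw [ha _ hx0, hn, mul_min_of_nonneg _ _ (by positivity)]
          generalize ρ⁻¹ * ‖x‖ = t at ht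
          have h1 := hI1 (t ^ (-((d : ℝ) / γ))) b (by positivity) hb0
          have h2 := hI2 (t ^ (-((d : ℝ) / γ))) b (by positivity) hb0
          rw [← Real.rpow_mul ht.le] at h1 h2
          have e1 : -((d : ℝ) / γ) * (γ / 2) = -((d:ℝ) / 2) := by field_simp
          have e2 : -((d : ℝ) / γ) * (2 * γ) = -(2 * (d:ℝ)) := by field_simp
          rw [e1] at h1
          rw [e2] at h2
          refine le_min (h1.trans ?_) (h2.trans ?_)
          · rw [mul_assoc]
            exact mul_le_mul_of_nonneg_right (by linarith) (by positivity)
          · rw [mul_assoc]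
            exact mul_le_mul_of_nonneg_right (by linarith) (by positivity)
      _ ≤ _ := setIntegral_le_integral hGs (Filter.Eventually.of_forall fun x => by
          simp only [Pi.zero_apply]; positivity)
      _ = _ := hGe
      _ ≤ _ := mul_le_mul_of_nonneg_right (le_max_right _ _) (by positivity)
end

section
/- Let d ≥ 1 be an integer, let 0 < γ < 1/2 and let δ satisfy 1/γ − 1 < δ < 1/γ. Then there exist R₀ ≥ 4 and constants 0 < c' ≤ C' < ∞ (depending only on d, γ and δ) such that for all r ≥ 2 and all R ≥ max(8r, R₀) one has c'·r^{d/δ}·R^{d(1−1/γ)(1−1/δ)} ≤ ∫_{{x ∈ ℝ^d : 2r ≤ |x| ≤ R/2}} ∫_0^1 min(v^{−γδ} r^d |x|^{−dδ}, 1) · min(v^{−γδ} R^{d(1−δ)}, 1) dv dx ≤ C'·r^{d/δ}·R^{d(1−1/γ)(1−1/δ)}. -/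
open MeasureTheory Real Set

/-- model function -/
noncomputable def mf (p q y : ℝ) : ℝ := if y ≤ 1 then y ^ (-p) else y ^ (-q)

lemma mf_int (p q : ℝ) (hp : p < 1) (hq : 1 < q) :
    IntegrableOn (mf p q) (Ioi 0) := by
  have h1 : IntegrableOn (mf p q) (Ioc 0 1) := by
    have h := intervalIntegral.intervalIntegrable_rpow' (a := 0) (b := 1) (r := -p) (by linarith)
    rw [intervalIntegrable_iff_integrableOn_Ioc_of_le zero_le_one] at h
    refine h.congr_fun (fun y hy => ?_) measurableSet_Ioc
    simp [mf, hy.2]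
  have h2 : IntegrableOn (mf p q) (Ioi 1) := by
    have h := integrableOn_Ioi_rpow_of_lt (a := -q) (by linarith) (zero_lt_one)
    refine h.congr_fun (fun y hy => ?_) measurableSet_Ioi
    simp [mf, not_le.2 (mem_Ioi.1 hy)]
  rw [← Ioc_union_Ioi_eq_Ioi (zero_le_one' ℝ)]
  exact h1.union h2

/-- scaled version -/
lemma mf_scale_int (p q T : ℝ) (hp : p < 1) (hq : 1 < q) (hT : 0 < T) :
    IntegrableOn (fun y => mf p q (y / T)) (Ioi 0) := by
  have := (integrableOn_Ioi_comp_mul_left_iff (mf p q) 0 (inv_pos.2 hT)).2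
    (by simpa using mf_int p q hp hq)
  simpa [div_eq_inv_mul] using this

lemma mf_scale (p q T : ℝ) (hT : 0 < T) :
    ∫ y in Ioi 0, mf p q (y / T) = T * ∫ y in Ioi 0, mf p q y := by
  have := integral_comp_mul_left_Ioi (mf p q) 0 (inv_pos.2 hT)
  simpa [div_eq_inv_mul] using this

lemma mf_nonneg (p q y : ℝ) (hy : 0 ≤ y) : 0 ≤ mf p q y := by
  unfold mf; split_ifs <;> positivity

lemma mf_const_nonneg (p q : ℝ) : 0 ≤ ∫ y in Ioi 0, mf p q y :=
  setIntegral_nonneg measurableSet_Ioi fun y hy => mf_nonneg p q y (le_of_lt hy)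

lemma inner_le (s a b : ℝ) (hs : 1 / 2 < s) (hs1 : s < 1) (ha : 0 < a) (hb : 0 < b) :
    ∫ v in Ioc (0 : ℝ) 1, min (v ^ (-s) * a) 1 * min (v ^ (-s) * b) 1 ≤
      b * a ^ (1 / s - 1) * ∫ y in Ioi 0, mf s (2 * s) y := by
  have hs0 : 0 < s := by linarith
  set T : ℝ := a ^ (1 / s) with hTdef
  have hT : 0 < T := by positivity
  have key : ∀ v : ℝ, 0 < v → (v / T) ^ (-s) = v ^ (-s) * a := by
    intro v hv
    rw [div_rpow hv.le hT.le, hTdef, ← rpow_mul ha.le]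
    have : 1 / s * -s = -1 := by field_simp
    rw [this, rpow_neg_one]; field_simp
  have hint : IntegrableOn (fun v => b / a * mf s (2 * s) (v / T)) (Ioi 0) := (mf_scale_int s (2 * s) T hs1 (by linarith) hT).const_mul (b / a)
  calc _ ≤ ∫ v in Ioc (0 : ℝ) 1, b / a * mf s (2 * s) (v / T) := by
        refine integral_mono_of_nonneg ?_ (hint.mono_set fun x hx => hx.1) ?_
        · filter_upwards [ae_restrict_mem measurableSet_Ioc] with v hv
          have := hv.1
          simp only [Pi.zero_apply]
          positivity
        · filter_upwards [ae_restrict_mem measurableSet_Ioc] with v hv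
          have hv0 := hv.1
          have h1 : 0 < v ^ (-s) := by positivity
          have hm2 : min (v ^ (-s) * b) 1 ≤ v ^ (-s) * b := min_le_left _ _
          have e : v ^ (-s) * b = b / a * (v / T) ^ (-s) := by
            rw [key v hv0]; field_simp
          have hm0 : 0 ≤ min (v ^ (-s) * b) 1 := by positivity
          unfold mf
          split_ifs with h
          · rw [← e]
            calc _ ≤ 1 * (v ^ (-s) * b) := by
                  gcongr
                  exact min_le_right _ _
              _ = _ := one_mul _
          · have : (v / T) ^ (-(2 * s)) = (v / T) ^ (-s) * (v / T) ^ (-s) := by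
              rw [← rpow_add (by positivity)]; ring_nf
            rw [this]
            calc _ ≤ (v ^ (-s) * a) * (v ^ (-s) * b) := by
                  gcongr
                  exact min_le_left _ _
              _ = _ := by rw [e, key v hv0]; ring
    _ ≤ ∫ v in Ioi (0 : ℝ), b / a * mf s (2 * s) (v / T) := by
        refine setIntegral_mono_set hint ?_ (LE.le.eventuallyLE fun x hx => hx.1)
        filter_upwards [ae_restrict_mem measurableSet_Ioi] with v hv
        have := mf_nonneg s (2 * s) (v / T) (div_nonneg (le_of_lt hv) hT.le)
        simp only [Pi.zero_apply]
        positivity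
    _ = _ := by
        rw [integral_const_mul, mf_scale _ _ _ hT, rpow_sub ha, rpow_one, ← hTdef]
        field_simp

lemma inner_ge (s a b κ : ℝ) (hs : 1 / 2 < s) (hb : 0 < b) (hb1 : b ≤ 1)
    (hκ : 0 < κ) (hκ1 : κ ≤ 1) (ha : κ * b ≤ a) :
    κ * b ^ (1 / s) ≤ 
    ∫ v in Ioc (0 : ℝ) 1, min (v ^ (-s) * a) 1 * min (v ^ (-s) * b) 1 := by
  have hs0 : 0 < s := by linarith
  have ha0 : 0 < a := by nlinarith
  set T : ℝ := b ^ (1 / s) with hTdef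
  have hT : 0 < T := by positivity
  have hT1 : T ≤ 1 := rpow_le_one hb.le hb1 (by positivity)
  have hint : IntegrableOn (fun v : ℝ => min (v ^ (-s) * a) 1 * min (v ^ (-s) * b) 1) (Ioc 0 1) := by
    refine Measure.integrableOn_of_bounded (M := 1) (by simp) ?_ ?_
    · apply Measurable.aestronglyMeasurable; fun_prop
    · filter_upwards [ae_restrict_mem measurableSet_Ioc] with v hv
      have hv0 := hv.1
      rw [norm_of_nonneg (by positivity)]
      calc _ ≤ (1:ℝ) * 1 := by
            gcongr <;> exact min_le_right _ _
        _ = 1 := one_mul _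
  calc _ = κ * volume.real (Ioc 0 T) := by simp [hT.le]
    _ ≤ ∫ v in Ioc 0 T, min (v ^ (-s) * a) 1 * min (v ^ (-s) * b) 1 := by
      refine setIntegral_ge_of_const_le_real measurableSet_Ioc (by simp) ?_ (hint.mono_set (Ioc_subset_Ioc_right hT1))
      intro v hv
      have hv0 := hv.1
      have h1 : 1 ≤ v ^ (-s) * b := by
        have : T ^ (-s) ≤ v ^ (-s) := rpow_le_rpow_of_nonpos hv0 hv.2 (by linarith)
        have e : T ^ (-s) = b⁻¹ := by
          rw [hTdef, ← rpow_mul hb.le]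
          have : 1 / s * -s = -1 := by field_simp
          rw [this, rpow_neg_one]
        rw [e] at this
        calc 1 = b⁻¹ * b := by field_simp
          _ ≤ _ := by gcongr
      have h2 : κ ≤ v ^ (-s) * a := by
        have : 0 < v ^ (-s) := by positivity
        nlinarith
      rw [min_eq_right h1, mul_one]
      exact le_min h2 hκ1
    _ ≤ _ := by
        refine setIntegral_mono_set hint ?_ (LE.le.eventuallyLE (Ioc_subset_Ioc_right hT1))
        filter_upwards [ae_restrict_mem measurableSet_Ioc] with v hv
        have := hv.1
        simp only [Pi.zero_apply]
        positivity

/-- the inner integral -/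
noncomputable def JJ (s a b : ℝ) : ℝ :=
  ∫ v in Ioc (0 : ℝ) 1, min (v ^ (-s) * a) 1 * min (v ^ (-s) * b) 1

lemma JJ_nonneg (s a b : ℝ) (ha : 0 ≤ a) (hb : 0 ≤ b) : 0 ≤ JJ s a b := by
  refine setIntegral_nonneg measurableSet_Ioc fun v hv => ?_
  have := hv.1
  positivity

lemma JJ_comm (s a b : ℝ) : JJ s a b = JJ s b a := by
  unfold JJ
  congr 1
  funext v
  exact mul_comm _ _

lemma JJ_le (s P b ρ y : ℝ) (hs : 1 / 2 < s) (hs1 : s < 1) (hb : 0 < b) (hρ : 0 < ρ)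
    (hy : 0 < y) :
    JJ s (b * (y / ρ) ^ (-P)) b ≤
      b ^ (1 / s) * (∫ y in Ioi 0, mf s (2 * s) y) * mf (P * (1 / s - 1)) P (y / ρ) := by
  have hz : 0 < y / ρ := by positivity
  have e : b ^ (1 / s) = b * b ^ (1 / s - 1) := by
    rw [rpow_sub hb, rpow_one]; field_simp
  unfold mf
  split_ifs with h
  · refine (inner_le s _ b hs hs1 (by positivity) hb).trans (le_of_eq ?_)
    rw [mul_rpow hb.le (by positivity), ← rpow_mul hz.le, e]
    unfold mf
    ring_nf
  · rw [JJ_comm]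
    refine (inner_le s _ _ hs hs1 hb (by positivity)).trans (le_of_eq ?_)
    rw [e]
    unfold mf
    ring

lemma outer_int (d : ℕ) (hd : 1 ≤ d) (p q ρ : ℝ) (hp : p < d) (hq : d < q) (hρ : 0 < ρ) :
    Integrable (fun x : EuclideanSpace ℝ (Fin d) => mf p q (‖x‖ / ρ)) ∧
    ∫ x : EuclideanSpace ℝ (Fin d), mf p q (‖x‖ / ρ) =
      ρ ^ d * (d * volume.real (Metric.ball (0 : EuclideanSpace ℝ (Fin d)) 1) *
        ∫ y in Ioi 0, mf (p - (d - 1)) (q - (d - 1)) y) := by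
  have : Nonempty (Fin d) := ⟨⟨0, hd⟩⟩
  have e : EqOn (fun y : ℝ => y ^ (d - 1) • mf p q (y / ρ))
      (fun y => ρ ^ (d - 1) * mf (p - (d - 1)) (q - (d - 1)) (y / ρ)) (Ioi 0) := by
    intro y hy
    have hy : 0 < y := hy
    have hz : 0 < y / ρ := by positivity
    have hz2 : y ^ (d - 1) = ρ ^ (d - 1) * (y / ρ) ^ ((d : ℝ) - 1) := by
      have : ((d : ℝ) - 1) = ((d - 1 : ℕ) : ℝ) := by push_cast [hd]; ring
      rw [this, rpow_natCast, ← mul_pow]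
      congr 1
      field_simp
    simp only [smul_eq_mul]
    rw [hz2, mul_assoc]
    congr 1
    unfold mf
    split_ifs <;> (rw [← rpow_add hz]; congr 1; ring)
  have hi : IntegrableOn (fun y => ρ ^ (d - 1) * mf (p - (d - 1)) (q - (d - 1)) (y / ρ)) (Ioi 0) :=
    (mf_scale_int _ _ ρ (by linarith) (by linarith) hρ).const_mul _
  constructor
  · rw [integrable_fun_norm_addHaar volume (f := fun y => mf p q (y / ρ))]
    simp only [finrank_euclideanSpace_fin]
    exact hi.congr_fun e.symm measurableSet_Ioi
  · rw [integral_fun_norm_addHaar volume (fun y => mf p q (y / ρ))]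
    simp only [finrank_euclideanSpace_fin]
    rw [setIntegral_congr_fun measurableSet_Ioi e, integral_const_mul, mf_scale _ _ _ hρ]
    obtain ⟨k, rfl⟩ : ∃ k, d = k + 1 := ⟨d - 1, by omega⟩
    simp only [nsmul_eq_mul, smul_eq_mul, Nat.add_sub_cancel]
    ring

lemma core (d : ℕ) (hd : 1 ≤ d) (s P : ℝ) (hs : 1 / 2 < s) (hs1 : s < 1)
    (hP : d < P) (hP2 : P * (1 / s - 1) < d) :
    ∃ c C : ℝ, 0 < c ∧ 0 < C ∧ ∀ b ρ r R : ℝ, 0 < b → b ≤ 1 → 0 < r → 8 * r ≤ R → r ≤ ρ → ρ ≤ R →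
      c * (b ^ (1 / s) * ρ ^ d) ≤
        (∫ x in {x : EuclideanSpace ℝ (Fin d) | 2 * r ≤ ‖x‖ ∧ ‖x‖ ≤ R / 2},
          JJ s (b * (‖x‖ / ρ) ^ (-P)) b) ∧
      (∫ x in {x : EuclideanSpace ℝ (Fin d) | 2 * r ≤ ‖x‖ ∧ ‖x‖ ≤ R / 2},
          JJ s (b * (‖x‖ / ρ) ^ (-P)) b) ≤ C * (b ^ (1 / s) * ρ ^ d) := by
  have : Nonempty (Fin d) := ⟨⟨0, hd⟩⟩
  set V := volume.real (Metric.ball (0 : EuclideanSpace ℝ (Fin d)) 1) with hV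
  have hVpos : 0 < V := by
    rw [hV]
    exact ENNReal.toReal_pos (Metric.measure_ball_pos _ _ one_pos).ne' measure_ball_lt_top.ne
  set K1 := ∫ y in Ioi 0, mf s (2 * s) y with hK1
  have hK1n : 0 ≤ K1 := mf_const_nonneg _ _
  set K2 := ∫ y in Ioi 0, mf (P * (1 / s - 1) - (d - 1)) (P - (d - 1)) y with hK2
  have hK2n : 0 ≤ K2 := mf_const_nonneg _ _
  have hP0 : 0 < P := lt_of_le_of_lt (Nat.cast_nonneg d) hP
  refine ⟨(4 : ℝ) ^ (-P) * ((1 / 8) ^ d * V), K1 * (d * V * K2) + 1, by positivity, by positivity, ?_⟩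
  intro b ρ r R hb hb1 hr hR hρr hρR
  have hρ : 0 < ρ := by linarith
  obtain ⟨hi1, hi2⟩ := outer_int d hd _ _ ρ hP2 hP hρ
  rw [← hV, ← hK2] at hi2
  set S := {x : EuclideanSpace ℝ (Fin d) | 2 * r ≤ ‖x‖ ∧ ‖x‖ ≤ R / 2} with hS
  have hSm : MeasurableSet S := by
    rw [hS]
    exact (measurableSet_le measurable_const measurable_norm).inter
      (measurableSet_le measurable_norm measurable_const)
  have hnn : ∀ x : EuclideanSpace ℝ (Fin d), 0 ≤ JJ s (b * (‖x‖ / ρ) ^ (-P)) b := fun x =>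
    JJ_nonneg _ _ _ (by positivity) hb.le
  have hi3 := hi1.const_mul (b ^ (1 / s) * K1)
  have hle : ∀ x ∈ S, JJ s (b * (‖x‖ / ρ) ^ (-P)) b ≤
      b ^ (1 / s) * K1 * mf (P * (1 / s - 1)) P (‖x‖ / ρ) := fun x hx =>
    JJ_le s P b ρ ‖x‖ hs hs1 hb hρ (by have := hx.1; linarith)
  have hmeas : StronglyMeasurable
      (fun x : EuclideanSpace ℝ (Fin d) => JJ s (b * (‖x‖ / ρ) ^ (-P)) b) := by
    unfold JJ
    apply StronglyMeasurable.integral_prod_right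
    apply Measurable.stronglyMeasurable
    unfold Function.uncurry
    fun_prop
  have hint : IntegrableOn (fun x => JJ s (b * (‖x‖ / ρ) ^ (-P)) b) S := by
    refine hi3.integrableOn.mono' hmeas.aestronglyMeasurable ?_
    filter_upwards [ae_restrict_mem hSm] with x hx
    rw [norm_of_nonneg (hnn x)]
    exact hle x hx
  constructor
  · set t := min (2 * ρ) (R / 4) with ht
    have ht1 : 2 * r ≤ t := le_min (by linarith) (by linarith)
    have ht2 : t ≤ 2 * ρ := min_le_left _ _
    have ht3 : t ≤ R / 4 := min_le_right _ _
    have ht4 : ρ / 4 ≤ t := le_min (by linarith) (by linarith)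
    have ht0 : 0 < t := by linarith
    obtain ⟨e, he⟩ := exists_norm_eq (EuclideanSpace ℝ (Fin d))
      (c := 3 / 2 * t) (by positivity)
    have hball : ∀ x ∈ Metric.closedBall e (t / 2), t ≤ ‖x‖ ∧ ‖x‖ ≤ 2 * t := by
      intro x hx
      rw [mem_closedBall_iff_norm] at hx
      have h1 := abs_norm_sub_norm_le x e
      have h2 := abs_le.1 (h1.trans hx)
      constructor <;> linarith [h2.1, h2.2]
    have hsub : Metric.closedBall e (t / 2) ⊆ S := fun x hx =>
      ⟨by linarith [(hball x hx).1], by linarith [(hball x hx).2]⟩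
    calc _ = ((4 : ℝ) ^ (-P) * b ^ (1 / s)) * ((ρ / 4 / 2) ^ d * V) := by
          have : ρ / 4 / 2 = 1 / 8 * ρ := by ring
          rw [this, mul_pow]; ring
      _ ≤ ((4 : ℝ) ^ (-P) * b ^ (1 / s)) * ((t / 2) ^ d * V) := by gcongr
      _ = ((4 : ℝ) ^ (-P) * b ^ (1 / s)) * volume.real (Metric.closedBall e (t / 2)) := by
          rw [Measure.addHaar_real_closedBall _ _ (by positivity)]
          simp [hV]
      _ ≤ ∫ x in Metric.closedBall e (t / 2), JJ s (b * (‖x‖ / ρ) ^ (-P)) b := by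
          refine setIntegral_ge_of_const_le_real Metric.isClosed_closedBall.measurableSet
            measure_closedBall_lt_top.ne ?_ (hint.mono_set hsub)
          intro x hx
          obtain ⟨hx1, hx2⟩ := hball x hx
          refine inner_ge s _ b ((4 : ℝ) ^ (-P)) hs hb hb1 (by positivity)
            (rpow_le_one_of_one_le_of_nonpos (by norm_num) (by linarith)) ?_
          rw [mul_comm]
          have hz : 0 < ‖x‖ / ρ := div_pos (by linarith) hρ
          have hz4 : ‖x‖ / ρ ≤ 4 := by rw [div_le_iff₀ hρ]; linarith
          exact mul_le_mul_of_nonneg_left (rpow_le_rpow_of_nonpos hz hz4 (by linarith)) hb.le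
      _ ≤ _ := setIntegral_mono_set hint (Filter.Eventually.of_forall fun x => hnn x)
          (LE.le.eventuallyLE hsub)
  · calc _ ≤ ∫ x in S, b ^ (1 / s) * K1 * mf (P * (1 / s - 1)) P (‖x‖ / ρ) :=
          integral_mono_of_nonneg (Filter.Eventually.of_forall fun x => hnn x) hi3.integrableOn
            (by filter_upwards [ae_restrict_mem hSm] with x hx using hle x hx)
      _ ≤ ∫ x : EuclideanSpace ℝ (Fin d), b ^ (1 / s) * K1 * mf (P * (1 / s - 1)) P (‖x‖ / ρ) := by
          refine setIntegral_le_integral hi3 (Filter.Eventually.of_forall fun x => ?_)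
          have := mf_nonneg (P * (1 / s - 1)) P (‖x‖ / ρ) (by positivity)
          simp only [Pi.zero_apply]
          positivity
      _ = K1 * (d * V * K2) * (b ^ (1 / s) * ρ ^ d) := by
          rw [integral_const_mul, hi2]; ring
      _ ≤ _ := by
          gcongr; linarith

/-- Two-edge annulus crossing integral in the regime `1/γ - 1 < δ < 1/γ`: for `2 ≤ r` and
`R ≥ max(8r, R₀)`,
`∫_{2r ≤ |x| ≤ R/2} ∫_0^1 min(v^{-γδ} r^d |x|^{-dδ}, 1) min(v^{-γδ} R^{d(1-δ)}, 1) dv dx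
  ≍ r^{d/δ} R^{d(1-1/γ)(1-1/δ)}`. -/
theorem stmt_17 (d : ℕ) (hd : 1 ≤ d) (γ δ : ℝ) (hγ0 : 0 < γ) (hγ1 : γ < 1 / 2)
    (hδ1 : 1 / γ - 1 < δ) (hδ2 : δ < 1 / γ) :
    ∃ R₀ : ℝ, 4 ≤ R₀ ∧ ∃ c' C' : ℝ, 0 < c' ∧ c' ≤ C' ∧
      ∀ r R : ℝ, 2 ≤ r → max (8 * r) R₀ ≤ R →
      c' * (r ^ ((d : ℝ) / δ) * R ^ ((d : ℝ) * (1 - 1 / γ) * (1 - 1 / δ))) ≤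
          (∫ x in {x : EuclideanSpace ℝ (Fin d) | 2 * r ≤ ‖x‖ ∧ ‖x‖ ≤ R / 2},
              ∫ v in Ioc (0 : ℝ) 1,
                min (v ^ (-(γ * δ)) * r ^ d * ‖x‖ ^ (-((d : ℝ) * δ))) 1 *
                  min (v ^ (-(γ * δ)) * R ^ ((d : ℝ) * (1 - δ))) 1) ∧
      (∫ x in {x : EuclideanSpace ℝ (Fin d) | 2 * r ≤ ‖x‖ ∧ ‖x‖ ≤ R / 2},
              ∫ v in Ioc (0 : ℝ) 1,
                min (v ^ (-(γ * δ)) * r ^ d * ‖x‖ ^ (-((d : ℝ) * δ))) 1 *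
                  min (v ^ (-(γ * δ)) * R ^ ((d : ℝ) * (1 - δ))) 1) ≤
          C' * (r ^ ((d : ℝ) / δ) * R ^ ((d : ℝ) * (1 - 1 / γ) * (1 - 1 / δ))) := by
  have hδ : 1 < δ := by
    have : 2 < 1 / γ := by rw [lt_div_iff₀ hγ0]; linarith
    linarith
  have hδ0 : 0 < δ := by linarith
  have hd0 : (0 : ℝ) < d := by exact_mod_cast hd
  have hs1 : γ * δ < 1 := by
    rw [lt_div_iff₀ hγ0] at hδ2; linarith
  have hs : 1 - γ < γ * δ := by
    have := mul_lt_mul_of_pos_left hδ1 hγ0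
    have e : γ * (1 / γ - 1) = 1 - γ := by field_simp
    linarith
  obtain ⟨c, C, hc, hC, H⟩ := core d hd (γ * δ) (d * δ) (by linarith) hs1 (by nlinarith) (by
    have e : (d : ℝ) * δ * (1 / (γ * δ) - 1) = d * (1 / γ - δ) := by field_simp
    rw [e]
    nlinarith)
  refine ⟨4, le_refl _, c, max c C, hc, le_max_left _ _, ?_⟩
  intro r R hr hRm
  have hR8 : 8 * r ≤ R := (le_max_left _ _).trans hRm
  have hr0 : 0 < r := by linarith
  have hR0 : 0 < R := by linarith
  have hinv : 1 / δ < 1 := by rw [div_lt_one hδ0]; exact hδ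
  have hinv0 : 0 < 1 / δ := by positivity
  set ρ : ℝ := r ^ (1 / δ) * R ^ (1 - 1 / δ) with hρdef
  have hρ : 0 < ρ := by positivity
  have hρr : r ≤ ρ := by
    calc r = r ^ (1 / δ) * r ^ (1 - 1 / δ) := by
          rw [← rpow_add hr0]; simp
      _ ≤ _ := by
          rw [hρdef]
          gcongr
          linarith
  have hρR : ρ ≤ R := by
    calc ρ ≤ R ^ (1 / δ) * R ^ (1 - 1 / δ) := by
          rw [hρdef]
          gcongr
          linarith
      _ = R := by rw [← rpow_add hR0]; simp
  set b : ℝ := R ^ ((d : ℝ) * (1 - δ)) with hb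
  have hb0 : 0 < b := by positivity
  have hb1 : b ≤ 1 := rpow_le_one_of_one_le_of_nonpos (by linarith) (by nlinarith)
  have hkey : b * ρ ^ ((d : ℝ) * δ) = r ^ d := by
    rw [hρdef, mul_rpow (by positivity) (by positivity), ← rpow_mul hr0.le, ← rpow_mul hR0.le, hb]
    have e1 : 1 / δ * (d * δ) = (d : ℝ) := by field_simp
    have e2 : (1 - 1 / δ) * (d * δ) = -((d : ℝ) * (1 - δ)) := by field_simp; ring
    rw [e1, e2, rpow_natCast, rpow_neg hR0.le]
    field_simp
  have htgt : b ^ (1 / (γ * δ)) * ρ ^ d =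
      r ^ ((d : ℝ) / δ) * R ^ ((d : ℝ) * (1 - 1 / γ) * (1 - 1 / δ)) := by
    rw [← rpow_natCast ρ d, hρdef, mul_rpow (by positivity) (by positivity), ← rpow_mul hr0.le,
      hb, ← rpow_mul hR0.le, ← rpow_mul hR0.le, mul_left_comm, ← rpow_add hR0]
    congr 2
    · ring
    · field_simp; ring
  have hI : (∫ x in {x : EuclideanSpace ℝ (Fin d) | 2 * r ≤ ‖x‖ ∧ ‖x‖ ≤ R / 2},
              ∫ v in Ioc (0 : ℝ) 1,
                min (v ^ (-(γ * δ)) * r ^ d * ‖x‖ ^ (-((d : ℝ) * δ))) 1 *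
                  min (v ^ (-(γ * δ)) * b) 1) =
      ∫ x in {x : EuclideanSpace ℝ (Fin d) | 2 * r ≤ ‖x‖ ∧ ‖x‖ ≤ R / 2},
          JJ (γ * δ) (b * (‖x‖ / ρ) ^ (-((d : ℝ) * δ))) b := by
    congr 1
    funext x
    have : b * (‖x‖ / ρ) ^ (-((d : ℝ) * δ)) = r ^ d * ‖x‖ ^ (-((d : ℝ) * δ)) := by
      rw [div_rpow (norm_nonneg _) hρ.le, rpow_neg hρ.le, ← hkey]
      field_simp
    unfold JJ
    simp only [this, mul_assoc]
  rw [hI, ← htgt]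
  obtain ⟨h1, h2⟩ := H b ρ r R hb0 hb1 hr0 hR8 hρr hρR
  refine ⟨h1, h2.trans ?_⟩
  gcongr
  exact le_max_right _ _
end
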